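/- arXiv:2511.06514 — 3 statements merged into one kernel-verified Lean document; each statement's English description precedes it below -/
import Mathlib

section
/- For every number of ports n ≥ 1, every buffer capacity B, and every arrival sequence σ, the Modified Harmonic policy is (2 + ln n)-competitive for online buffer sharing: the number of packets accepted by the Modified Harmonic policy is at least 1/(2 + ln n) times the number of packets accepted by any feasible (offline, optimal) acceptance policy on σ, i.e., (2 + ln n)·|HAR| ≥ |OPT|. -/
open scoped Classical

noncomputable section

/-! ## Model of online buffer sharing

A switch has `n` output ports and a shared buffer of capacity `B`.
An arrival sequence consists of `m` packets; packet `i : Fin m` arrives at time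
`t i : ℕ` and is destined to output port `dest i : Fin n`.  Packets are totally
ordered by their arrival, and we assume the index order refines the arrival-time
order (`Monotone t`).  An acceptance policy is identified with the set
`S : Finset (Fin m)` of packets it accepts.  Accepted packets join the FIFO queue
of their destination port, and at each integer time `s = 1, 2, …` every nonempty
queue transmits (removes) one packet. -/

/-- Number of packets of `S` destined to `q`, arriving at time `s`, with index `< i`. -/
def arrivalsBefore (m n : ℕ) (t : Fin m → ℕ) (dest : Fin m → Fin n)
    (S : Finset (Fin m)) (q : Fin n) (s : ℕ) (i : ℕ) : ℕ :=
  Set.ncard {j : Fin m | j ∈ S ∧ dest j = q ∧ t j = s ∧ (j : ℕ) < i}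

/-- Number of packets of `S` destined to `q` arriving at time `s`. -/
def arrivalsAt (m n : ℕ) (t : Fin m → ℕ) (dest : Fin m → Fin n)
    (S : Finset (Fin m)) (q : Fin n) (s : ℕ) : ℕ :=
  arrivalsBefore m n t dest S q s m

/-- Occupancy of queue `q` under acceptance set `S` at the end of integer time
step `s`: at each integer time `s ≥ 1` the queue first transmits one packet
(if nonempty), then the packets arriving at time `s` join the queue. -/
def lenAt (m n : ℕ) (t : Fin m → ℕ) (dest : Fin m → Fin n)
    (S : Finset (Fin m)) (q : Fin n) : ℕ → ℕ
  | 0 => arrivalsAt m n t dest S q 0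
  | s + 1 => (lenAt m n t dest S q s - 1) + arrivalsAt m n t dest S q (s + 1)

/-- Occupancy of queue `q` under acceptance set `S` at the moment packet `i`
arrives (just before the decision on `i` is made): packets arriving at the same
time are processed in index order. -/
def occ (m n : ℕ) (t : Fin m → ℕ) (dest : Fin m → Fin n)
    (S : Finset (Fin m)) (i : Fin m) (q : Fin n) : ℕ :=
  if t i = 0 then arrivalsBefore m n t dest S q 0 (i : ℕ)
  else (lenAt m n t dest S q (t i - 1) - 1) + arrivalsBefore m n t dest S q (t i) (i : ℕ)

/-- A policy (acceptance set) is feasible if the shared buffer capacity `B` is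
never exceeded, i.e. right after any acceptance the total occupancy is `≤ B`. -/
def Feasible (m n B : ℕ) (t : Fin m → ℕ) (dest : Fin m → Fin n)
    (S : Finset (Fin m)) : Prop :=
  ∀ i ∈ S, (∑ q : Fin n, occ m n t dest S i q) + 1 ≤ B

/-- The thresholds of the Harmonic policy: `T k = (B / (1 + ln n)) · (1 / k)`. -/
def thr (n B : ℕ) (k : ℕ) : ℝ :=
  (B : ℝ) / (1 + Real.log n) * (1 / (k : ℝ))

/-- The acceptance condition of the Modified Harmonic policy for packet `i`,
given that the previously accepted packets are `S`: compute the smallest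
threshold `T k` strictly exceeding the occupancy of queue `dest i` (as the
thresholds are decreasing in `k`, this is the largest such `k`), and accept iff
after accepting, at most `k` queues have occupancy at least `T k`. -/
def harAccepts (m n B : ℕ) (t : Fin m → ℕ) (dest : Fin m → Fin n)
    (S : Finset (Fin m)) (i : Fin m) : Prop :=
  ∃ k ∈ Finset.Icc 1 n,
    ((occ m n t dest S i (dest i) : ℝ) < thr n B k) ∧
    (∀ k' ∈ Finset.Icc 1 n,
      ((occ m n t dest S i (dest i) : ℝ) < thr n B k') → k' ≤ k) ∧
    Set.ncard {q : Fin n |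
      thr n B k ≤ ((occ m n t dest S i q + if q = dest i then 1 else 0 : ℕ) : ℝ)} ≤ k

/-- The set of packets among the first `j` packets accepted by the Modified
Harmonic policy (decisions are made online, in arrival order). -/
def harAux (m n B : ℕ) (t : Fin m → ℕ) (dest : Fin m → Fin n) : ℕ → Finset (Fin m)
  | 0 => ∅
  | j + 1 =>
    if h : j < m then
      if harAccepts m n B t dest (harAux m n B t dest j) ⟨j, h⟩ then
        insert ⟨j, h⟩ (harAux m n B t dest j)
      else harAux m n B t dest j
    else harAux m n B t dest j

/-- The set of packets accepted by the Modified Harmonic policy. -/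
def HAR (m n B : ℕ) (t : Fin m → ℕ) (dest : Fin m → Fin n) : Finset (Fin m) :=
  harAux m n B t dest m

theorem card_filter_of_iff_or_eq {α : Type*} {S : Finset α} {A A' : α → Prop} {i : α} {c : Prop}
    [DecidablePred A] [DecidablePred A'] [Decidable (i ∈ S ∧ c)]
    (hA : c → ¬ A i) (h : ∀ j, A' j ↔ A j ∨ (j = i ∧ c)) :
    (S.filter A').card = (S.filter A).card + if i ∈ S ∧ c then 1 else 0 := by
  split_ifs with hc
  · rw [← Finset.card_insert_of_notMem (a := i) (s := S.filter A) (by simp [hA hc.2])]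
    congr 1
    ext j
    simp only [Finset.mem_filter, Finset.mem_insert, h]
    grind
  · congr 1
    ext j
    simp only [Finset.mem_filter, h]
    grind

/-- Induction over the states `(s, i)` of the system: time `s`, with the packets of index `< i`
arriving at time `s` already processed. -/
theorem state_induction {m : ℕ} {Q : ℕ → ℕ → Prop} (zero : Q 0 0)
    (arrive : ∀ s i, i < m → Q s i → Q s (i + 1)) (transmit : ∀ s, Q s m → Q (s + 1) 0) :
    ∀ s i, i ≤ m → Q s i := by
  have inner : ∀ s, Q s 0 → ∀ i, i ≤ m → Q s i := by
    intro s hs i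
    induction i with
    | zero => exact fun _ => hs
    | succ i ih => exact fun hi => arrive s i hi (ih (by omega))
  intro s
  induction s with
  | zero => exact inner 0 zero
  | succ s ih => exact inner (s + 1) (transmit s (ih m le_rfl))

section Queue

variable {m n : ℕ} {t : Fin m → ℕ} {dest : Fin m → Fin n} {S : Finset (Fin m)} {q : Fin n}

/-- Packet `j` has been processed in state `(s, i)`. -/
def Processed (t : Fin m → ℕ) (s i : ℕ) (j : Fin m) : Prop :=
  t j < s ∨ t j = s ∧ (j : ℕ) < i

/-- Occupancy of queue `q` in state `(s, i)`. -/
def stateLen (t : Fin m → ℕ) (dest : Fin m → Fin n) (S : Finset (Fin m)) (q : Fin n)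
    (s i : ℕ) : ℕ :=
  (if s = 0 then 0 else lenAt m n t dest S q (s - 1) - 1) + arrivalsBefore m n t dest S q s i

/-- Number of packets of `S` for queue `q` processed in state `(s, i)`. -/
def acceptedBefore (t : Fin m → ℕ) (dest : Fin m → Fin n) (S : Finset (Fin m)) (q : Fin n)
    (s i : ℕ) : ℕ :=
  (S.filter fun j => dest j = q ∧ Processed t s i j).card

/-- The last integer time at which packet `j` would still be stored, if accepted. -/
def lastTime (t : Fin m → ℕ) (dest : Fin m → Fin n) (S : Finset (Fin m)) (j : Fin m) : ℕ :=
  t j + occ m n t dest S j (dest j)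

theorem arrivalsBefore_eq_card (s i : ℕ) : arrivalsBefore m n t dest S q s i =
    (S.filter fun j => dest j = q ∧ t j = s ∧ (j : ℕ) < i).card := by
  rw [arrivalsBefore, ← Set.ncard_coe_finset]
  congr 1
  ext j
  simp

theorem occ_eq_stateLen (j : Fin m) : occ m n t dest S j q = stateLen t dest S q (t j) j := by
  unfold occ stateLen
  split_ifs with h <;> simp [h]

theorem lenAt_eq_stateLen (s : ℕ) : lenAt m n t dest S q s = stateLen t dest S q s m := by
  cases s <;> simp [lenAt, stateLen, arrivalsAt]

theorem stateLen_zero : stateLen t dest S q 0 0 = 0 := by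
  simp [stateLen, arrivalsBefore]

theorem stateLen_transmit (s : ℕ) :
    stateLen t dest S q (s + 1) 0 = stateLen t dest S q s m - 1 := by
  rw [← lenAt_eq_stateLen]
  simp [stateLen, arrivalsBefore]

theorem stateLen_arrive (s : ℕ) {i : ℕ} (hi : i < m) :
    stateLen t dest S q s (i + 1) = stateLen t dest S q s i +
      if (⟨i, hi⟩ : Fin m) ∈ S ∧ dest ⟨i, hi⟩ = q ∧ t ⟨i, hi⟩ = s then 1 else 0 := by
  rw [stateLen, stateLen, add_assoc, arrivalsBefore_eq_card, arrivalsBefore_eq_card]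
  congr 1
  refine card_filter_of_iff_or_eq ?_ fun j => ?_
  · simp
  rw [Nat.lt_succ_iff_lt_or_eq, Fin.ext_iff]
  grind

theorem acceptedBefore_zero : acceptedBefore t dest S q 0 0 = 0 := by
  simp [acceptedBefore, Processed]

theorem processed_transmit (s : ℕ) (j : Fin m) : Processed t (s + 1) 0 j ↔ Processed t s m j := by
  have := j.isLt
  simp only [Processed]
  omega

theorem processed_arrive (s : ℕ) {i : ℕ} (hi : i < m) (j : Fin m) :
    Processed t s (i + 1) j ↔ Processed t s i j ∨ (j = ⟨i, hi⟩ ∧ t ⟨i, hi⟩ = s) := by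
  simp only [Processed, Nat.lt_succ_iff_lt_or_eq, Fin.ext_iff]
  grind

theorem acceptedBefore_transmit (s : ℕ) :
    acceptedBefore t dest S q (s + 1) 0 = acceptedBefore t dest S q s m := by
  simp only [acceptedBefore, processed_transmit]

theorem acceptedBefore_arrive (s : ℕ) {i : ℕ} (hi : i < m) :
    acceptedBefore t dest S q s (i + 1) = acceptedBefore t dest S q s i +
      if (⟨i, hi⟩ : Fin m) ∈ S ∧ dest ⟨i, hi⟩ = q ∧ t ⟨i, hi⟩ = s then 1 else 0 := by
  unfold acceptedBefore
  refine card_filter_of_iff_or_eq ?_ fun j => ?_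
  · simp +contextual [Processed]
  rw [processed_arrive s hi]
  grind

theorem lastTime_lt (s i : ℕ) (hi : i ≤ m) : ∀ j ∈ S, dest j = q → Processed t s i j →
    lastTime t dest S j < s + stateLen t dest S q s i := by
  revert s i
  refine state_induction ?_ ?_ ?_
  · simp [Processed]
  · intro s i hi ih j hj hq hp
    rw [stateLen_arrive s hi]
    rcases (processed_arrive s hi j).1 hp with hp | ⟨rfl, ht⟩
    · have := ih j hj hq hp
      omega
    · rw [if_pos ⟨hj, hq, ht⟩, lastTime, occ_eq_stateLen, hq, ht]
      dsimp only
      omega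
  · intro s ih j hj hq hp
    have := ih j hj hq ((processed_transmit s j).1 hp)
    rw [stateLen_transmit]
    omega

theorem exists_lastTime_eq (s i : ℕ) (hi : i ≤ m) : ∀ k < stateLen t dest S q s i,
    ∃ j ∈ S, dest j = q ∧ lastTime t dest S j = s + k := by
  revert s i
  refine state_induction ?_ ?_ ?_
  · simp [stateLen_zero]
  · intro s i hi ih k hk
    rw [stateLen_arrive s hi] at hk
    by_cases hlt : k < stateLen t dest S q s i
    · exact ih k hlt
    · split_ifs at hk with hc
      · refine ⟨⟨i, hi⟩, hc.1, hc.2.1, ?_⟩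
        rw [lastTime, occ_eq_stateLen, hc.2.1, hc.2.2]
        dsimp only
        omega
      · omega
  · intro s ih k hk
    rw [stateLen_transmit] at hk
    obtain ⟨j, hj, hq, h⟩ := ih (k + 1) (by omega)
    exact ⟨j, hj, hq, by omega⟩

theorem lastTime_injOn (ht : Monotone t) :
    Set.InjOn (lastTime t dest S) {j | j ∈ S ∧ dest j = q} := by
  have key : ∀ j ∈ S, ∀ k, dest j = dest k → j < k →
      lastTime t dest S j < lastTime t dest S k := by
    intro j hj k hjk hlt
    have h : lastTime t dest S k = t k + stateLen t dest S (dest k) (t k) k := by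
      rw [lastTime, occ_eq_stateLen]
    rw [h]
    refine lastTime_lt _ _ k.isLt.le j hj hjk ?_
    rcases (ht hlt.le).lt_or_eq with h | h
    · exact Or.inl h
    · exact Or.inr ⟨h, hlt⟩
  rintro j ⟨hj, hjq⟩ k ⟨hk, hkq⟩ h
  rcases lt_trichotomy j k with hlt | rfl | hlt
  · exact absurd h (key j hj k (hjq.trans hkq.symm) hlt).ne
  · rfl
  · exact absurd h (key k hk j (hkq.trans hjq.symm) hlt).ne'

theorem card_stored_le_stateLen (ht : Monotone t) (s : ℕ) :
    (S.filter fun j => dest j = q ∧ t j ≤ s ∧ s ≤ lastTime t dest S j).card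
      ≤ stateLen t dest S q s m := by
  rw [← Nat.add_sub_cancel_left (n := s) (m := stateLen t dest S q s m), ← Nat.card_Ico]
  refine Finset.card_le_card_of_injOn (lastTime t dest S) ?_ ?_
  · intro j hj
    simp only [Finset.coe_filter, Set.mem_ofPred_eq] at hj
    obtain ⟨hj, hq, hts, hs⟩ := hj
    simp only [Finset.coe_Ico, Set.mem_Ico]
    refine ⟨hs, lastTime_lt s m le_rfl j hj hq ?_⟩
    rcases hts.lt_or_eq with h | h
    · exact Or.inl h
    · exact Or.inr ⟨h, j.isLt⟩
  · refine (lastTime_injOn ht (q := q)).mono fun j hj => ?_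
    simp only [Finset.coe_filter, Set.mem_ofPred_eq] at hj
    exact ⟨hj.1, hj.2.1⟩

theorem sum_stateLen_le {B : ℕ} (hS : Feasible m n B t dest S) (s i : ℕ) (hi : i ≤ m) :
    ∑ q, stateLen t dest S q s i ≤ B := by
  revert s i
  refine state_induction ?_ ?_ ?_
  · simp [stateLen_zero]
  · intro s i hi ih
    by_cases hc : (⟨i, hi⟩ : Fin m) ∈ S ∧ t ⟨i, hi⟩ = s
    · have hf := hS _ hc.1
      simp only [occ_eq_stateLen, hc.2] at hf
      simpa [stateLen_arrive s hi, hc, Finset.sum_add_distrib] using hf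
    · refine (Finset.sum_le_sum fun q _ => ?_).trans ih
      rw [stateLen_arrive s hi, if_neg (by tauto), add_zero]
  · intro s ih
    refine (Finset.sum_le_sum fun q _ => ?_).trans ih
    rw [stateLen_transmit]
    omega

theorem card_stored_le {B : ℕ} (ht : Monotone t) (hS : Feasible m n B t dest S) (s : ℕ) :
    (S.filter fun j => t j ≤ s ∧ s ≤ lastTime t dest S j).card ≤ B := by
  refine le_trans ?_ (sum_stateLen_le hS s m le_rfl)
  rw [Finset.card_eq_sum_card_fiberwise (f := dest) (t := Finset.univ) (by simp)]
  refine Finset.sum_le_sum fun q _ => le_trans (le_of_eq ?_) (card_stored_le_stateLen ht s)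
  rw [Finset.filter_filter]
  congr 1
  ext j
  simp only [Finset.mem_filter]
  tauto

end Queue

section Comparison

variable {m n : ℕ} {t : Fin m → ℕ} {dest : Fin m → Fin n}

/-- Packets accepted by `S` and rejected by `A` which join a queue that is at least as long
under `S` as under `A`. -/
def excess (t : Fin m → ℕ) (dest : Fin m → Fin n) (S A : Finset (Fin m)) : Finset (Fin m) :=
  (S \ A).filter fun j => occ m n t dest A j (dest j) ≤ occ m n t dest S j (dest j)

theorem acceptedBefore_le (S A : Finset (Fin m)) (q : Fin n) (s i : ℕ) (hi : i ≤ m) :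
    acceptedBefore t dest S q s i + (stateLen t dest A q s i - stateLen t dest S q s i) ≤
      acceptedBefore t dest A q s i + acceptedBefore t dest (excess t dest S A) q s i := by
  revert s i
  refine state_induction ?_ ?_ ?_
  · simp [acceptedBefore_zero, stateLen_zero]
  · intro s i hi ih
    rw [acceptedBefore_arrive s hi, acceptedBefore_arrive s hi, acceptedBefore_arrive s hi,
      stateLen_arrive s hi, stateLen_arrive s hi]
    by_cases hc : dest ⟨i, hi⟩ = q ∧ t ⟨i, hi⟩ = s
    · have he : (⟨i, hi⟩ : Fin m) ∈ excess t dest S A ↔ ((⟨i, hi⟩ : Fin m) ∈ S ∧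
          (⟨i, hi⟩ : Fin m) ∉ A) ∧ stateLen t dest A q s i ≤ stateLen t dest S q s i := by
        simp [excess, occ_eq_stateLen, hc]
      simp only [he, hc, and_true]
      split_ifs <;> grind
    · simpa [hc] using ih
  · intro s ih
    rw [acceptedBefore_transmit, acceptedBefore_transmit, acceptedBefore_transmit,
      stateLen_transmit, stateLen_transmit]
    omega

theorem sum_acceptedBefore (S : Finset (Fin m)) :
    ∑ q, acceptedBefore t dest S q (Finset.univ.sup t) m = S.card := by
  rw [Finset.card_eq_sum_card_fiberwise (f := dest) (t := Finset.univ) (by simp)]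
  refine Finset.sum_congr rfl fun q _ => ?_
  rw [acceptedBefore]
  congr 1
  refine Finset.filter_congr fun j _ => and_iff_left ?_
  rcases (Finset.le_sup (f := t) (Finset.mem_univ j)).lt_or_eq with h | h
  · exact Or.inl h
  · exact Or.inr ⟨h, j.isLt⟩

theorem card_le_card_add_card_excess (S A : Finset (Fin m)) :
    S.card ≤ A.card + (excess t dest S A).card := by
  rw [← sum_acceptedBefore (t := t) (dest := dest) S, ← sum_acceptedBefore (t := t) (dest := dest) A,
    ← sum_acceptedBefore (t := t) (dest := dest) (excess t dest S A), ← Finset.sum_add_distrib]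
  refine Finset.sum_le_sum fun q _ => ?_
  have := acceptedBefore_le (t := t) (dest := dest) S A q (Finset.univ.sup t) m le_rfl
  omega

end Comparison

section Harmonic

variable {m n B : ℕ} {t : Fin m → ℕ} {dest : Fin m → Fin n}

theorem mem_harAux_succ (i j : Fin m) : j ∈ harAux m n B t dest (i + 1) ↔
    j ∈ harAux m n B t dest i ∨
      (j = i ∧ harAccepts m n B t dest (harAux m n B t dest i) i) := by
  rw [harAux, dif_pos i.isLt]
  split_ifs with h
  · simp [h, or_comm]
  · simp [h]

theorem mem_harAux_iff_of_le {i k : ℕ} (hik : i ≤ k) (hk : k ≤ m) (j : Fin m) (hj : (j : ℕ) < i) :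
    j ∈ harAux m n B t dest k ↔ j ∈ harAux m n B t dest i := by
  induction k, hik using Nat.le_induction with
  | base => rfl
  | succ k hik ih =>
    rw [mem_harAux_succ ⟨k, hk⟩ j, ih (by omega)]
    refine or_iff_left fun h => ?_
    have := congrArg Fin.val h.1
    dsimp only at this
    omega

theorem stateLen_congr {S S' : Finset (Fin m)} (q : Fin n) (s i : ℕ) (hi : i ≤ m) :
    (∀ j, Processed t s i j → (j ∈ S ↔ j ∈ S')) →
      stateLen t dest S q s i = stateLen t dest S' q s i := by
  revert s i
  refine state_induction ?_ ?_ ?_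
  · simp [stateLen_zero]
  · intro s i hi ih h
    simp only [processed_arrive s hi] at h
    rw [stateLen_arrive s hi, stateLen_arrive s hi, ih fun j hj => h j (Or.inl hj)]
    grind
  · intro s ih h
    rw [stateLen_transmit, stateLen_transmit,
      ih fun j hj => h j ((processed_transmit s j).2 hj)]

theorem occ_harAux (ht : Monotone t) (i : Fin m) (q : Fin n) :
    occ m n t dest (harAux m n B t dest i) i q = occ m n t dest (HAR m n B t dest) i q := by
  rw [occ_eq_stateLen, occ_eq_stateLen]
  refine stateLen_congr q _ _ i.isLt.le fun j hj => ?_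
  refine (mem_harAux_iff_of_le i.isLt.le le_rfl j ?_).symm
  rcases hj with h | h
  · exact ht.reflect_lt h
  · exact h.2

theorem not_harAccepts_of_notMem (i : Fin m) (hi : i ∉ HAR m n B t dest) :
    ¬ harAccepts m n B t dest (harAux m n B t dest i) i := by
  intro h
  exact hi ((mem_harAux_iff_of_le (Nat.succ_le_of_lt i.isLt) le_rfl i (Nat.lt_succ_self _)).2
    ((mem_harAux_succ i i).2 (Or.inr ⟨rfl, h⟩)))

theorem one_add_log_pos (n : ℕ) : 0 < 1 + Real.log n := by
  have := Real.log_natCast_nonneg n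
  linarith

theorem thr_succ_le (k : ℕ) (hk : 1 ≤ k) : thr n B (k + 1) ≤ thr n B k := by
  have := one_add_log_pos n
  have : (0 : ℝ) < k := by exact_mod_cast hk
  unfold thr
  gcongr
  simp

/-- When a packet is rejected, then for some `r` its queue is one of at least `r` queues of
occupancy at least `T r`. -/
theorem exists_thr_le_of_not_harAccepts (hn : 1 ≤ n) {S : Finset (Fin m)} {i : Fin m}
    (h : ¬ harAccepts m n B t dest S i) :
    ∃ r, 1 ≤ r ∧ thr n B r ≤ occ m n t dest S i (dest i) ∧
      r ≤ (Finset.univ.filter fun q => thr n B r ≤ (occ m n t dest S i q : ℝ)).card := by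
  set K := (Finset.Icc 1 n).filter fun k => (occ m n t dest S i (dest i) : ℝ) < thr n B k
  by_cases hne : K.Nonempty
  · obtain ⟨hk, hlt⟩ := Finset.mem_filter.1 (K.max'_mem hne)
    have hmax : ∀ k' ∈ Finset.Icc 1 n,
        (occ m n t dest S i (dest i) : ℝ) < thr n B k' → k' ≤ K.max' hne :=
      fun k' h1 h2 => K.le_max' k' (Finset.mem_filter.2 ⟨h1, h2⟩)
    generalize K.max' hne = k at hk hlt hmax
    have hcard : k < Set.ncard {q : Fin n |
        thr n B k ≤ ((occ m n t dest S i q + if q = dest i then 1 else 0 : ℕ) : ℝ)} := by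
      by_contra hle
      exact h ⟨k, hk, hlt, hmax, not_lt.1 hle⟩
    have hkn : k < n := by
      refine hcard.trans_le ((Set.ncard_le_card _).trans ?_)
      simp
    have hocc : thr n B (k + 1) ≤ occ m n t dest S i (dest i) := by
      by_contra hlt'
      have := hmax (k + 1) (Finset.mem_Icc.2 ⟨by omega, hkn⟩) (not_le.1 hlt')
      omega
    refine ⟨k + 1, by omega, hocc, hcard.trans_le ?_⟩
    rw [← Set.ncard_coe_finset]
    refine Set.ncard_le_ncard fun q hq => ?_
    simp only [Set.mem_ofPred_eq] at hq
    simp only [Finset.coe_filter, Finset.mem_univ, true_and, Set.mem_ofPred_eq]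
    by_cases hqd : q = dest i
    · rwa [hqd]
    · rw [if_neg hqd, add_zero] at hq
      exact (thr_succ_le k (Finset.mem_Icc.1 hk).1).trans hq
  · have hocc : thr n B 1 ≤ occ m n t dest S i (dest i) := by
      by_contra hlt
      exact hne ⟨1, Finset.mem_filter.2 ⟨Finset.mem_Icc.2 ⟨le_rfl, hn⟩, not_le.1 hlt⟩⟩
    exact ⟨1, le_rfl, hocc, Finset.card_pos.2 ⟨dest i, by simpa using hocc⟩⟩

/-- While an excess packet is stored, at least `B / (1 + ln n)` packets leave the buffer of the
Harmonic policy. -/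
theorem le_card_leaving (hn : 1 ≤ n) (ht : Monotone t) (S : Finset (Fin m)) {i : Fin m}
    (hi : i ∈ excess t dest S (HAR m n B t dest)) :
    (B : ℝ) / (1 + Real.log n) ≤ ((HAR m n B t dest).filter fun j =>
      t i ≤ lastTime t dest (HAR m n B t dest) j ∧
        lastTime t dest (HAR m n B t dest) j ≤ lastTime t dest S i).card := by
  obtain ⟨hmem, hle⟩ := Finset.mem_filter.1 hi
  obtain ⟨r, hr, hocc, hcard⟩ := exists_thr_le_of_not_harAccepts hn
    (not_harAccepts_of_notMem i (Finset.mem_sdiff.1 hmem).2)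
  simp only [occ_harAux ht] at hocc hcard
  set A := HAR m n B t dest
  set Q := Finset.univ.filter fun q => thr n B r ≤ (occ m n t dest A i q : ℝ)
  have hsub : Q ×ˢ Finset.range ⌈thr n B r⌉₊ ⊆ (A.filter fun j =>
      t i ≤ lastTime t dest A j ∧ lastTime t dest A j ≤ lastTime t dest S i).image
        fun j => (dest j, lastTime t dest A j - t i) := by
    rintro ⟨q, k⟩ hqk
    obtain ⟨hq, hk⟩ := Finset.mem_product.1 hqk
    have hkr := Finset.mem_range.1 hk
    have hkq : k < stateLen t dest A q (t i) i := by
      rw [← occ_eq_stateLen]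
      exact hkr.trans_le (Nat.ceil_le.2 (Finset.mem_filter.1 hq).2)
    obtain ⟨j, hj, hjq, hjk⟩ := exists_lastTime_eq (t i) i i.isLt.le k hkq
    have hkS : k < occ m n t dest S i (dest i) := (hkr.trans_le (Nat.ceil_le.2 hocc)).trans_le hle
    refine Finset.mem_image.2 ⟨j, Finset.mem_filter.2 ⟨hj, ?_, ?_⟩, ?_⟩
    · omega
    · rw [hjk, lastTime]
      omega
    · rw [hjq, hjk, Nat.add_sub_cancel_left]
  have hprod : r * ⌈thr n B r⌉₊ ≤ (A.filter fun j =>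
      t i ≤ lastTime t dest A j ∧ lastTime t dest A j ≤ lastTime t dest S i).card := by
    refine le_trans ?_ ((Finset.card_le_card hsub).trans Finset.card_image_le)
    rw [Finset.card_product, Finset.card_range]
    exact Nat.mul_le_mul_right _ hcard
  have hr0 : (r : ℝ) ≠ 0 := by
    exact_mod_cast (by omega : r ≠ 0)
  calc (B : ℝ) / (1 + Real.log n) = r * thr n B r := by
        unfold thr
        field_simp
    _ ≤ r * (⌈thr n B r⌉₊ : ℝ) := by
        gcongr
        exact Nat.le_ceil _
    _ ≤ _ := by exact_mod_cast hprod

theorem card_excess_le (hn : 1 ≤ n) (hB : 1 ≤ B) (ht : Monotone t) {S : Finset (Fin m)}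
    (hS : Feasible m n B t dest S) :
    ((excess t dest S (HAR m n B t dest)).card : ℝ) ≤
      (1 + Real.log n) * (HAR m n B t dest).card := by
  set A := HAR m n B t dest
  set R : Fin m → Fin m → Prop := fun i j =>
    t i ≤ lastTime t dest A j ∧ lastTime t dest A j ≤ lastTime t dest S i
  have hB0 : (0 : ℝ) < B := by exact_mod_cast hB
  have hH := one_add_log_pos n
  have hcount : ((excess t dest S A).card : ℝ) * (B / (1 + Real.log n)) ≤ A.card * B := by
    calc ((excess t dest S A).card : ℝ) * (B / (1 + Real.log n))
        ≤ ∑ i ∈ excess t dest S A, ((A.filter fun j => R i j).card : ℝ) := by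
          rw [← nsmul_eq_mul]
          exact Finset.card_nsmul_le_sum _ _ _ fun i hi => le_card_leaving hn ht S hi
      _ = ∑ j ∈ A, (((excess t dest S A).filter fun i => R i j).card : ℝ) := by
          exact_mod_cast Finset.sum_card_bipartiteAbove_eq_sum_card_bipartiteBelow R
      _ ≤ A.card * B := by
          rw [← nsmul_eq_mul]
          refine Finset.sum_le_card_nsmul _ _ _ fun j _ => ?_
          refine Nat.cast_le.2 (le_trans (Finset.card_le_card ?_)
            (card_stored_le ht hS (lastTime t dest A j)))
          refine Finset.filter_subset_filter _ ?_
          exact (Finset.filter_subset _ _).trans Finset.sdiff_subset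
  rw [mul_div_assoc', div_le_iff₀ hH] at hcount
  exact le_of_mul_le_mul_right (by linarith) hB0

end Harmonic

/-- The Modified Harmonic policy is `(2 + ln n)`-competitive:
for every `n ≥ 1`, every buffer capacity `B ≥ 1` and every arrival sequence,
`(2 + ln n) · |HAR| ≥ |OPT|`, where `OPT` is an optimal feasible (offline)
acceptance policy. -/
theorem harmonic_is_two_plus_log_competitive
    (n B m : ℕ) (hn : 1 ≤ n) (hB : 1 ≤ B)
    (t : Fin m → ℕ) (dest : Fin m → Fin n) (ht : Monotone t)
    (OPT : Finset (Fin m))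
    (hOPTfeas : Feasible m n B t dest OPT)
    (hOPTopt : ∀ S : Finset (Fin m), Feasible m n B t dest S → S.card ≤ OPT.card) :
    (OPT.card : ℝ) ≤ (2 + Real.log n) * ((HAR m n B t dest).card : ℝ) := by
  have h1 : (OPT.card : ℝ) ≤ (HAR m n B t dest).card +
      (excess t dest OPT (HAR m n B t dest)).card := by
    exact_mod_cast card_le_card_add_card_excess OPT (HAR m n B t dest)
  have h2 := card_excess_le hn hB ht hOPTfeas
  linarith

end
end

section
/- Let P_A = OPT ∩ HAR, and let P_B be the set of packets p ∈ OPT \ HAR such that at the time p arrives, the occupancy of p's destination queue in Harmonic's buffer is strictly greater than the occupancy of p's destination queue in OPT's buffer. Then |HAR| ≥ |P_A| + |P_B|. -/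
open scoped Classical

noncomputable section

/-- Occupancy of queue `q` at time `s`, right after the transmission and before any arrival. -/
def residualLen (m n : ℕ) (t : Fin m → ℕ) (dest : Fin m → Fin n)
    (S : Finset (Fin m)) (q : Fin n) : ℕ → ℕ
  | 0 => 0
  | s + 1 => lenAt m n t dest S q s - 1

theorem lenAt_eq_residual_add {m n : ℕ} (t : Fin m → ℕ) (dest : Fin m → Fin n)
    (S : Finset (Fin m)) (q : Fin n) (s : ℕ) :
    lenAt m n t dest S q s = residualLen m n t dest S q s + arrivalsBefore m n t dest S q s m := by
  cases s <;> simp [lenAt, residualLen, arrivalsAt]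

theorem occ_eq_residual_add {m n : ℕ} (t : Fin m → ℕ) (dest : Fin m → Fin n)
    (S : Finset (Fin m)) (i : Fin m) (q : Fin n) :
    occ m n t dest S i q =
      residualLen m n t dest S q (t i) + arrivalsBefore m n t dest S q (t i) i := by
  unfold occ
  cases h : t i <;> simp [residualLen]

theorem arrivalsBefore_zero {m n : ℕ} (t : Fin m → ℕ) (dest : Fin m → Fin n)
    (S : Finset (Fin m)) (q : Fin n) (s : ℕ) : arrivalsBefore m n t dest S q s 0 = 0 := by
  simp [arrivalsBefore]

theorem arrivalsBefore_succ {m n : ℕ} (t : Fin m → ℕ) (dest : Fin m → Fin n)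
    (S : Finset (Fin m)) (q : Fin n) (s : ℕ) (i : Fin m) :
    arrivalsBefore m n t dest S q s (i + 1) = arrivalsBefore m n t dest S q s i +
      if i ∈ S ∧ dest i = q ∧ t i = s then 1 else 0 := by
  unfold arrivalsBefore
  split_ifs with h
  · rw [← Set.ncard_insert_of_notMem (a := i) (by simp)]
    congr 1
    ext j
    simp only [Set.mem_ofPred_eq, Set.mem_insert_iff]
    constructor
    · rintro ⟨h1, h2, h3, h4⟩
      by_cases hj : (j : ℕ) = i
      · exact Or.inl (Fin.ext hj)
      · exact Or.inr ⟨h1, h2, h3, by omega⟩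
    · rintro (rfl | ⟨h1, h2, h3, h4⟩)
      · exact ⟨h.1, h.2.1, h.2.2, by omega⟩
      · exact ⟨h1, h2, h3, by omega⟩
  · rw [add_zero]
    congr 1
    ext j
    simp only [Set.mem_ofPred_eq]
    constructor
    · rintro ⟨h1, h2, h3, h4⟩
      refine ⟨h1, h2, h3, lt_of_le_of_ne (by omega) fun hj => h ?_⟩
      rw [← Fin.ext hj]
      exact ⟨h1, h2, h3⟩
    · rintro ⟨h1, h2, h3, h4⟩
      exact ⟨h1, h2, h3, by omega⟩

theorem card_eq_sum_arrivalsBefore {m n : ℕ} (t : Fin m → ℕ) (dest : Fin m → Fin n)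
    (S : Finset (Fin m)) {N : ℕ} (hN : ∀ i, t i < N) :
    S.card = ∑ q : Fin n, ∑ s ∈ Finset.range N, arrivalsBefore m n t dest S q s m := by
  rw [Finset.card_eq_sum_card_fiberwise (f := dest) (t := Finset.univ) (by simp)]
  refine Finset.sum_congr rfl fun q _ => ?_
  rw [Finset.card_eq_sum_card_fiberwise (f := t) (t := Finset.range N)
    (fun i _ => by simpa using hN i)]
  refine Finset.sum_congr rfl fun s _ => ?_
  rw [arrivalsBefore, ← Set.ncard_coe_finset]
  congr 1
  ext j
  simp [and_assoc]

/-- During one time step, packets accepted only by `O` while the queue is longer under `H` are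
paid for by packets accepted only by `H`, with the excess of the queue under `H` as potential. -/
theorem add_arrivalsBefore_add_excess_le {m n : ℕ} (t : Fin m → ℕ) (dest : Fin m → Fin n)
    (H O P : Finset (Fin m)) (q : Fin n) (s a d : ℕ)
    (hP : ∀ i, i ∈ P ↔ i ∈ O ∧ i ∉ H ∧
      occ m n t dest O i (dest i) < occ m n t dest H i (dest i))
    (h₀ : a + (residualLen m n t dest H q s - residualLen m n t dest O q s) ≤ d) :
    ∀ i ≤ m,
      a + arrivalsBefore m n t dest P q s i +
          ((residualLen m n t dest H q s + arrivalsBefore m n t dest H q s i) -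
            (residualLen m n t dest O q s + arrivalsBefore m n t dest O q s i)) ≤
        d + arrivalsBefore m n t dest (H \ O) q s i := by
  intro i
  induction i with
  | zero => simpa [arrivalsBefore_zero] using h₀
  | succ i ih =>
    intro hi
    have h := ih (by omega)
    have e := fun S => arrivalsBefore_succ t dest S q s ⟨i, hi⟩
    have hPi := hP ⟨i, hi⟩
    simp only at e
    rw [e, e, e, e]
    by_cases hq : dest ⟨i, hi⟩ = q ∧ t ⟨i, hi⟩ = s
    · obtain ⟨hq, hs⟩ := hq
      rw [occ_eq_residual_add, occ_eq_residual_add, hq, hs] at hPi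
      simp only [hq, hs, and_true, hPi, Finset.mem_sdiff]
      by_cases hO : (⟨i, hi⟩ : Fin m) ∈ O <;> by_cases hH : (⟨i, hi⟩ : Fin m) ∈ H <;>
        simp only [hO, hH, not_true_eq_false, not_false_eq_true, true_and, false_and, and_true,
          and_false, if_true, if_false] <;>
        (try split_ifs) <;> omega
    · simpa [hq] using h

theorem sum_arrivalsBefore_add_excess_le {m n : ℕ} (t : Fin m → ℕ) (dest : Fin m → Fin n)
    (H O P : Finset (Fin m)) (q : Fin n)
    (hP : ∀ i, i ∈ P ↔ i ∈ O ∧ i ∉ H ∧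
      occ m n t dest O i (dest i) < occ m n t dest H i (dest i)) (s : ℕ) :
    ∑ r ∈ Finset.range s, arrivalsBefore m n t dest P q r m +
        (residualLen m n t dest H q s - residualLen m n t dest O q s) ≤
      ∑ r ∈ Finset.range s, arrivalsBefore m n t dest (H \ O) q r m := by
  induction s with
  | zero => simp [residualLen]
  | succ s ih =>
    have h := add_arrivalsBefore_add_excess_le t dest H O P q s _ _ hP ih m le_rfl
    simp only [← lenAt_eq_residual_add] at h
    simp only [Finset.sum_range_succ, residualLen]
    omega

theorem card_le_card_sdiff_of_shorter_queue {m n : ℕ} (t : Fin m → ℕ) (dest : Fin m → Fin n)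
    (H O P : Finset (Fin m))
    (hP : ∀ i, i ∈ P ↔ i ∈ O ∧ i ∉ H ∧
      occ m n t dest O i (dest i) < occ m n t dest H i (dest i)) :
    P.card ≤ (H \ O).card := by
  have hN : ∀ i, t i < ∑ j, t j + 1 := fun i =>
    Nat.lt_succ_of_le (Finset.single_le_sum (fun j _ => Nat.zero_le (t j)) (Finset.mem_univ i))
  rw [card_eq_sum_arrivalsBefore t dest P hN, card_eq_sum_arrivalsBefore t dest (H \ O) hN]
  exact Finset.sum_le_sum fun q _ =>
    le_trans (Nat.le_add_right _ _) (sum_arrivalsBefore_add_excess_le t dest H O P q hP _)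

/-- Let `P_A = OPT ∩ HAR`, and let `P_B` be the set of packets
`p ∈ OPT \ HAR` such that, at the time `p` arrives, the occupancy of `p`'s
destination queue in Harmonic's buffer is strictly greater than the occupancy of
`p`'s destination queue in `OPT`'s buffer.  Then `|HAR| ≥ |P_A| + |P_B|`. -/
theorem har_card_ge_PA_add_PB
    (n B m : ℕ) (hn : 1 ≤ n) (hB : 1 ≤ B)
    (t : Fin m → ℕ) (dest : Fin m → Fin n) (ht : Monotone t)
    (OPT : Finset (Fin m))
    (hOPTfeas : Feasible m n B t dest OPT)
    (hOPTopt : ∀ S : Finset (Fin m), Feasible m n B t dest S → S.card ≤ OPT.card)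
    (PA PB : Finset (Fin m))
    (hPA : PA = OPT ∩ HAR m n B t dest)
    (hPB : PB = OPT.filter (fun i => i ∉ HAR m n B t dest ∧
      occ m n t dest OPT i (dest i) < occ m n t dest (HAR m n B t dest) i (dest i))) :
    PA.card + PB.card ≤ (HAR m n B t dest).card := by
  have h := card_le_card_sdiff_of_shorter_queue t dest (HAR m n B t dest) OPT PB
    (fun i => by rw [hPB, Finset.mem_filter])
  rw [hPA, Finset.inter_comm, ← Finset.card_inter_add_card_sdiff (HAR m n B t dest) OPT]
  exact Nat.add_le_add_left h _

end
end

section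
/- Suppose the Modified Harmonic policy rejects an arriving packet p, and let T_k be the threshold that triggered the rejection (i.e., T_k is the smallest threshold strictly exceeding the current occupancy of p's destination queue in Harmonic's buffer, and accepting p would result in strictly more than k queues having occupancy at least T_k). Then at the moment of rejection, Harmonic's buffer contains at least k queues with occupancy at least T_k, and hence the total occupancy of Harmonic's buffer is at least k·⌈T_k⌉ ≥ B/(1 + ln n). -/
open scoped Classical

noncomputable section

/-- Adding one unit to a single queue increases the number of queues that reach a given level by at
most one. -/
theorem ncard_le_ncard_add_one_of_single {n : ℕ} (f : Fin n → ℕ) (d : Fin n) (c : ℝ) :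
    Set.ncard {q : Fin n | c ≤ ((f q + if q = d then 1 else 0 : ℕ) : ℝ)} ≤
      Set.ncard {q : Fin n | c ≤ (f q : ℝ)} + 1 := by
  refine (Set.ncard_le_ncard ?_ (Set.toFinite _)).trans
    (Set.ncard_insert_le d {q : Fin n | c ≤ (f q : ℝ)})
  intro q hq
  by_cases h : q = d
  · exact Or.inl h
  · exact Or.inr (by simpa [h] using hq)

/-- If at least `k` queues have occupancy at least `c`, the total occupancy is at least
`k * ⌈c⌉₊`. -/
theorem mul_ceil_le_sum_of_le_ncard {n : ℕ} (f : Fin n → ℕ) (c : ℝ) {k : ℕ}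
    (h : k ≤ Set.ncard {q : Fin n | c ≤ (f q : ℝ)}) :
    k * ⌈c⌉₊ ≤ ∑ q : Fin n, f q := by
  rw [Set.ncard_eq_toFinset_card', Set.toFinset_ofPred] at h
  calc k * ⌈c⌉₊ ≤ (Finset.univ.filter fun q => c ≤ (f q : ℝ)).card * ⌈c⌉₊ :=
        Nat.mul_le_mul_right _ h
    _ ≤ ∑ q with c ≤ (f q : ℝ), f q := by
        rw [← smul_eq_mul]
        exact Finset.card_nsmul_le_sum _ _ _ fun q hq =>
          Nat.ceil_le.mpr (Finset.mem_filter.mp hq).2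
    _ ≤ ∑ q : Fin n, f q := Finset.sum_le_sum_of_subset (Finset.filter_subset _ _)

/-- `k` times the rounded-up threshold `T k` is at least `B / (1 + ln n)`. -/
theorem div_le_mul_ceil_thr (n B : ℕ) {k : ℕ} (hk : 1 ≤ k) :
    (B : ℝ) / (1 + Real.log n) ≤ ((k * ⌈thr n B k⌉₊ : ℕ) : ℝ) := by
  have hk0 : (k : ℝ) ≠ 0 := by positivity
  calc (B : ℝ) / (1 + Real.log n) = k * thr n B k := by
        rw [thr, mul_left_comm, mul_one_div_cancel hk0, mul_one]
    _ ≤ k * ⌈thr n B k⌉₊ := by gcongr; exact Nat.le_ceil _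
    _ = ((k * ⌈thr n B k⌉₊ : ℕ) : ℝ) := by push_cast; rfl

/-- Suppose the Modified Harmonic policy rejects an arriving
packet `i`, and let `T k` be the threshold that triggered the rejection: `T k`
is the smallest threshold strictly exceeding the current occupancy of `i`'s
destination queue in Harmonic's buffer (as the thresholds are decreasing in `k`,
this is the largest such `k`), and accepting `i` would result in strictly more
than `k` queues having occupancy at least `T k`.  Then, at the moment of the
rejection, Harmonic's buffer contains at least `k` queues with occupancy at
least `T k`, and hence the total occupancy of Harmonic's buffer is at least
`k · ⌈T k⌉ ≥ B / (1 + ln n)`. -/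
theorem rejection_total_occupancy_lower_bound
    (n B m : ℕ) (hn : 1 ≤ n) (hB : 1 ≤ B)
    (t : Fin m → ℕ) (dest : Fin m → Fin n) (ht : Monotone t)
    (i : Fin m) (S : Finset (Fin m))
    (hS : S = harAux m n B t dest (i : ℕ))
    (k : ℕ) (hk : k ∈ Finset.Icc 1 n)
    (hlt : (occ m n t dest S i (dest i) : ℝ) < thr n B k)
    (hmin : ∀ k' ∈ Finset.Icc 1 n,
      ((occ m n t dest S i (dest i) : ℝ) < thr n B k') → k' ≤ k)
    (hrej : k < Set.ncard {q : Fin n |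
      thr n B k ≤ ((occ m n t dest S i q + if q = dest i then 1 else 0 : ℕ) : ℝ)}) :
    k ≤ Set.ncard {q : Fin n | thr n B k ≤ (occ m n t dest S i q : ℝ)} ∧
    k * ⌈thr n B k⌉₊ ≤ ∑ q : Fin n, occ m n t dest S i q ∧
    (B : ℝ) / (1 + Real.log n) ≤ ((k * ⌈thr n B k⌉₊ : ℕ) : ℝ) := by
  have hcard : k ≤ Set.ncard {q : Fin n | thr n B k ≤ (occ m n t dest S i q : ℝ)} :=
    Nat.le_of_lt_succ (hrej.trans_le (ncard_le_ncard_add_one_of_single _ _ _))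
  exact ⟨hcard, mul_ceil_le_sum_of_le_ncard _ _ hcard,
    div_le_mul_ceil_thr n B (Finset.mem_Icc.mp hk).1⟩

end
end
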